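/- Fix n ≥ 1, a subset Λ₋ ⊆ ℝ^{2n+1}, a subset L ⊆ ℝ × ℝ^{2n+1}, and a real number s₋ < 0 such that L ∩ ((−∞, s₋] × ℝ^{2n+1}) = (−∞, s₋] × Λ₋ (i.e., L is cylindrical over Λ₋ below level s₋). If for some r > 0 there exists a relative symplectic embedding of B^{2n+2}(r) into ((−∞,0) × ℝ^{2n+1}, (−∞,0) × Λ₋), then there exists a relative symplectic embedding of B^{2n+2}(e^{s₋/2} r) into ((−∞,0) × ℝ^{2n+1}, L ∩ ((−∞,0) × ℝ^{2n+1})). Consequently e^{s₋} · w((ℝ × Λ₋)_{−∞}^0) ≤ w(L_{−∞}^0), where w denotes the relative Gromov width. (This is the embedding-level form of inequality (1.3) of Theorem 1.4 of the paper; the proof translates the given embedding downward by s₋, into the region where L is the cylinder over Λ₋, after rescaling the ball by e^{s₋/2}.) -/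

import Mathlib

noncomputable section

open Real Set

/-- Euclidean dot product on `Fin m → ℝ`. -/
def dotp {m : ℕ} (a b : Fin m → ℝ) : ℝ := ∑ i, a i * b i

/-- Sum of squares (square of the Euclidean norm). -/
def nsq {m : ℕ} (a : Fin m → ℝ) : ℝ := ∑ i, (a i)^2

/-- The contactization ℝ^{2n+1}, with points (x, y, z) ∈ ℝⁿ × ℝⁿ × ℝ. -/
abbrev CPt (n : ℕ) := (Fin n → ℝ) × (Fin n → ℝ) × ℝ

/-- The symplectization ℝ × ℝ^{2n+1}, with points (s, x, y, z). -/
abbrev SPt (n : ℕ) := ℝ × CPt n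

/-- The symplectization form Ω at the point P, the coordinate expression of d(e^s(dz − y·dx)). -/
def Omega (n : ℕ) (P v w : SPt n) : ℝ :=
  Real.exp P.1 *
    (v.1 * (w.2.2.2 - dotp P.2.2.1 w.2.1) - w.1 * (v.2.2.2 - dotp P.2.2.1 v.2.1)
      + dotp v.2.1 w.2.2.1 - dotp w.2.1 v.2.2.1)

/-- The domain ℝ^{2n+2} = ℝ^{n+1} × ℝ^{n+1} of the embedded balls. -/
abbrev Dom (n : ℕ) := (Fin (n+1) → ℝ) × (Fin (n+1) → ℝ)

/-- The standard symplectic form ω₀ on ℝ^{2n+2} = ℝ^{n+1} × ℝ^{n+1}. -/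
def omega0 (n : ℕ) (v w : Dom n) : ℝ := dotp v.1 w.2 - dotp v.2 w.1

/-- The closed round ball B^{2n+2}(r) of radius r centered at 0. -/
def ballD (n : ℕ) (r : ℝ) : Set (Dom n) := {v | nsq v.1 + nsq v.2 ≤ r^2}

/-- A relative symplectic embedding of B^{2n+2}(r) into the pair (X, L): injective on
the ball, smooth on a neighborhood of the ball, derivative intertwines ω₀ with Ω, and the
preimage of L is exactly the real part B^{2n+2}(r) ∩ (ℝ^{n+1} × {0}). -/
def IsRelSymplEmb (n : ℕ) (r : ℝ) (X L : Set (SPt n)) (ψ : Dom n → SPt n) : Prop :=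
  (∀ p ∈ ballD n r, ψ p ∈ X) ∧
  Set.InjOn ψ (ballD n r) ∧
  (∃ U : Set (Dom n), IsOpen U ∧ ballD n r ⊆ U ∧ ContDiffOn ℝ (⊤ : ℕ∞) ψ U) ∧
  (∀ p ∈ ballD n r, ∀ v w : Dom n,
    Omega n (ψ p) (fderiv ℝ ψ p v) (fderiv ℝ ψ p w) = omega0 n v w) ∧
  (∀ p ∈ ballD n r, (ψ p ∈ L ↔ p.2 = 0))

/-- The relative Gromov width of (X, L): the supremum in [0,∞] of πr² over all radii r > 0
admitting a relative symplectic embedding of B^{2n+2}(r) into (X, L). -/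
def relWidth (n : ℕ) (X L : Set (SPt n)) : ENNReal :=
  ⨆ r ∈ {r : ℝ | 0 < r ∧ ∃ ψ, IsRelSymplEmb n r X L ψ}, ENNReal.ofReal (π * r^2)

lemma dotp_smul_smul {m : ℕ} (a b : ℝ) (v w : Fin m → ℝ) :
    dotp (a • v) (b • w) = a * b * dotp v w := by
  simp only [dotp, Pi.smul_apply, smul_eq_mul, Finset.mul_sum]
  exact Finset.sum_congr rfl fun i _ => by ring

lemma nsq_smul {m : ℕ} (a : ℝ) (v : Fin m → ℝ) : nsq (a • v) = a ^ 2 * nsq v := by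
  simp [nsq, Finset.mul_sum, mul_pow]

lemma omega0_smul_smul (n : ℕ) (a : ℝ) (v w : Dom n) :
    omega0 n (a • v) (a • w) = a ^ 2 * omega0 n v w := by
  simp only [omega0, Prod.smul_fst, Prod.smul_snd, dotp_smul_smul]
  ring

/-- Translation in the symplectization direction rescales `Omega` by an exponential factor. -/
lemma Omega_translate (n : ℕ) (t : ℝ) (P v w : SPt n) :
    Omega n ((t, 0) + P) v w = Real.exp t * Omega n P v w := by
  simp only [Omega, Prod.fst_add, Prod.snd_add, zero_add, Real.exp_add]
  ring

lemma smul_mem_ballD_iff {n : ℕ} {a r : ℝ} (ha : a ≠ 0) {p : Dom n} :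
    a • p ∈ ballD n (a * r) ↔ p ∈ ballD n r := by
  have ha2 : 0 < a ^ 2 := by positivity
  simp only [ballD, Set.mem_ofPred_eq, Prod.smul_fst, Prod.smul_snd, nsq_smul, mul_pow, ← mul_add]
  exact mul_le_mul_iff_right₀ ha2

/-- Translating by `t` in the symplectization direction turns a relative symplectic embedding of
the ball of radius `r` into one of the ball of radius `exp (t / 2) * r`. -/
lemma IsRelSymplEmb.translate {n : ℕ} {r t : ℝ} {X L X' L' : Set (SPt n)} {ψ : Dom n → SPt n}
    (h : IsRelSymplEmb n r X L ψ) (hX : ∀ P ∈ X, (t, 0) + P ∈ X')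
    (hL : ∀ P ∈ X, ((t, 0) + P ∈ L' ↔ P ∈ L)) :
    IsRelSymplEmb n (Real.exp (t / 2) * r) X' L'
      (fun p => (t, 0) + ψ ((Real.exp (t / 2))⁻¹ • p)) := by
  obtain ⟨hmaps, hinj, ⟨U, hU, hUball, hsmooth⟩, hsymp, hrel⟩ := h
  set a := Real.exp (t / 2) with ha_def
  have ha : a ≠ 0 := (Real.exp_pos _).ne'
  have hexp : Real.exp t = a ^ 2 := by
    rw [ha_def, ← Real.exp_nat_mul]
    congr 1
    push_cast
    ring
  have hball : ∀ p ∈ ballD n (a * r), a⁻¹ • p ∈ ballD n r := fun p hp => by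
    rwa [← smul_mem_ballD_iff ha, smul_inv_smul₀ ha]
  refine ⟨fun p hp => hX _ (hmaps _ (hball p hp)), fun p hp q hq hpq => ?_,
    ⟨(fun p => a⁻¹ • p) ⁻¹' U, hU.preimage (continuous_const_smul _),
      fun p hp => hUball (hball p hp), ?_⟩, fun p hp v w => ?_, fun p hp => ?_⟩
  · exact smul_right_injective _ (inv_ne_zero ha)
      (hinj (hball p hp) (hball q hq) (add_left_cancel hpq))
  · exact contDiffOn_const.add
      (hsmooth.comp (contDiff_const_smul _).contDiffOn (fun p hp => hp))
  · have hderiv : ∀ u, fderiv ℝ (fun p => ((t, 0) : SPt n) + ψ (a⁻¹ • p)) p u =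
        fderiv ℝ ψ (a⁻¹ • p) (a⁻¹ • u) := fun u => by
      rw [fderiv_const_add, fderiv_comp_smul, map_smul]
      rfl
    rw [hderiv, hderiv, Omega_translate, hsymp _ (hball p hp), omega0_smul_smul, hexp]
    field_simp
  · rw [hL _ (hmaps _ (hball p hp)), hrel _ (hball p hp)]
    simp [ha]

/-- If every relative embedding of a ball of radius `r` yields one of radius `a * r`, then the
relative widths compare with the factor `a ^ 2`. -/
lemma relWidth_mul_le {n : ℕ} {a : ℝ} (ha : 0 < a) {X L X' L' : Set (SPt n)}
    (h : ∀ r > (0 : ℝ), (∃ ψ, IsRelSymplEmb n r X L ψ) →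
      ∃ ψ, IsRelSymplEmb n (a * r) X' L' ψ) :
    ENNReal.ofReal (a ^ 2) * relWidth n X L ≤ relWidth n X' L' := by
  simp only [relWidth, ENNReal.mul_iSup]
  refine iSup₂_le fun r hr => ?_
  have hmem : a * r ∈ {r : ℝ | 0 < r ∧ ∃ ψ, IsRelSymplEmb n r X' L' ψ} :=
    ⟨mul_pos ha hr.1, h r hr.1 hr.2⟩
  rw [← ENNReal.ofReal_mul (by positivity), show a ^ 2 * (π * r ^ 2) = π * (a * r) ^ 2 by ring]
  exact le_iSup₂ (f := fun r _ => ENNReal.ofReal (π * r ^ 2)) (a * r) hmem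

/-!
STATEMENT 3: If L is cylindrical over Λ₋ below the level s₋ < 0, then every relative
symplectic embedding of B^{2n+2}(r) into ((−∞,0) × ℝ^{2n+1}, (−∞,0) × Λ₋) yields one of
B^{2n+2}(e^{s₋/2} r) into ((−∞,0) × ℝ^{2n+1}, L ∩ ((−∞,0) × ℝ^{2n+1})); consequently
e^{s₋} · w((ℝ × Λ₋)_{−∞}^0) ≤ w(L_{−∞}^0). (Inequality (1.3) of Theorem 1.4.)
-/

theorem width_negative_end (n : ℕ) (hn : 1 ≤ n) (Λm : Set (CPt n)) (L : Set (SPt n))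
    (sm : ℝ) (hs : sm < 0)
    (hcyl : L ∩ (Set.Iic sm ×ˢ (Set.univ : Set (CPt n))) = Set.Iic sm ×ˢ Λm) :
    (∀ r > (0 : ℝ),
      (∃ ψ : Dom n → SPt n,
        IsRelSymplEmb n r (Set.Iio (0 : ℝ) ×ˢ (Set.univ : Set (CPt n)))
          (Set.Iio (0 : ℝ) ×ˢ Λm) ψ) →
      (∃ ψ : Dom n → SPt n,
        IsRelSymplEmb n (Real.exp (sm / 2) * r)
          (Set.Iio (0 : ℝ) ×ˢ (Set.univ : Set (CPt n)))
          (L ∩ (Set.Iio (0 : ℝ) ×ˢ (Set.univ : Set (CPt n)))) ψ)) ∧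
    ENNReal.ofReal (Real.exp sm) *
        relWidth n (Set.Iio (0 : ℝ) ×ˢ (Set.univ : Set (CPt n))) (Set.Iio (0 : ℝ) ×ˢ Λm)
      ≤ relWidth n (Set.Iio (0 : ℝ) ×ˢ (Set.univ : Set (CPt n)))
          (L ∩ (Set.Iio (0 : ℝ) ×ˢ (Set.univ : Set (CPt n)))) := by
  have hemb : ∀ r > (0 : ℝ),
      (∃ ψ : Dom n → SPt n,
        IsRelSymplEmb n r (Set.Iio (0 : ℝ) ×ˢ (Set.univ : Set (CPt n)))
          (Set.Iio (0 : ℝ) ×ˢ Λm) ψ) →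
      (∃ ψ : Dom n → SPt n,
        IsRelSymplEmb n (Real.exp (sm / 2) * r)
          (Set.Iio (0 : ℝ) ×ˢ (Set.univ : Set (CPt n)))
          (L ∩ (Set.Iio (0 : ℝ) ×ˢ (Set.univ : Set (CPt n)))) ψ) := by
    rintro r - ⟨ψ, hψ⟩
    refine ⟨_, hψ.translate ?_ ?_⟩
    · rintro ⟨s, c⟩ ⟨hs0, -⟩
      exact ⟨add_neg hs hs0, trivial⟩
    · rintro ⟨s, c⟩ ⟨hs0, -⟩
      have hs0 : s < 0 := hs0
      have hlow : sm + s ≤ sm := by linarith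
      have hneg : sm + s < 0 := by linarith
      have hmem := Set.ext_iff.mp hcyl (sm + s, c)
      simp only [Set.mem_inter_iff, Set.mem_prod, Set.mem_Iic, Set.mem_univ, and_true, hlow,
        true_and] at hmem
      simp [hmem, hs0, hneg]
  refine ⟨hemb, ?_⟩
  have hexp : Real.exp sm = Real.exp (sm / 2) ^ 2 := by
    rw [← Real.exp_nat_mul]
    congr 1
    push_cast
    ring
  rw [hexp]
  exact relWidth_mul_le (Real.exp_pos _) hemb
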